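/- arXiv:math/9912140 — 3 statements merged into one kernel-verified Lean document; each statement's English description precedes it below -/
import Mathlib

section
/- Let a, γ, x be complex numbers with x ≠ 0 and (a;q)_n ≠ 0 for all n ≥ 0. Then the little q-Bessel function satisfies the second-order q-difference equation (a/x)·(j_γ(q·x;a;q) − j_γ(x;a;q)) + (q/x)·(j_γ(q⁻¹·x;a;q) − j_γ(x;a;q)) = −q·γ·j_γ(x;a;q). -/
/-- The q-shifted factorial `(a;q)_n = ∏_{j=0}^{n-1} (1 - a q^j)`. -/
noncomputable def qPoch (a q : ℂ) (n : ℕ) : ℂ := ∏ j ∈ Finset.range n, (1 - a * q ^ j)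

/-- The little q-Bessel (Hahn-Exton q-Bessel) function
`j_γ(x;a;q) = ∑_{n≥0} (-1)^n q^{n(n-1)/2} / ((a;q)_n (q;q)_n) (qγx)^n`. -/
noncomputable def littleQBessel (q a γ x : ℂ) : ℂ :=
  ∑' n : ℕ, (-1) ^ n * q ^ (n * (n - 1) / 2) /
    (qPoch a q n * qPoch q q n) * (q * γ * x) ^ n

lemma qPoch_succ (a q : ℂ) (n : ℕ) : qPoch a q (n + 1) = qPoch a q n * (1 - a * q ^ n) :=
  Finset.prod_range_succ _ n

lemma one_sub_mul_pow_ne_zero_of_qPoch {a q : ℂ} (ha : ∀ n, qPoch a q n ≠ 0) (n : ℕ) :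
    1 - a * q ^ n ≠ 0 := fun h => ha (n + 1) (by rw [qPoch_succ, h, mul_zero])

lemma one_sub_pow_succ_ne_zero {q : ℂ} (hq : ‖q‖ < 1) (n : ℕ) : 1 - q ^ (n + 1) ≠ 0 := by
  intro h
  have h1 : ‖q ^ (n + 1)‖ < 1 := by
    rw [norm_pow]
    exact pow_lt_one₀ (norm_nonneg _) hq n.succ_ne_zero
  rw [← sub_eq_zero.mp h, norm_one] at h1
  exact lt_irrefl _ h1

lemma qPoch_self_ne_zero {q : ℂ} (hq : ‖q‖ < 1) (n : ℕ) : qPoch q q n ≠ 0 := by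
  refine Finset.prod_ne_zero_iff.mpr fun j _ => ?_
  rw [← pow_succ']
  exact one_sub_pow_succ_ne_zero hq j

/-- The `n`-th term of the series defining `littleQBessel`. -/
noncomputable def littleQBesselTerm (q a γ x : ℂ) (n : ℕ) : ℂ :=
  (-1) ^ n * q ^ (n * (n - 1) / 2) / (qPoch a q n * qPoch q q n) * (q * γ * x) ^ n

lemma littleQBesselTerm_mul (q a γ c x : ℂ) (n : ℕ) :
    littleQBesselTerm q a γ (c * x) n = c ^ n * littleQBesselTerm q a γ x n := by
  simp only [littleQBesselTerm, mul_pow]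
  ring

lemma littleQBesselTerm_succ {q a : ℂ} (γ x : ℂ) (hq : ‖q‖ < 1) (ha : ∀ n, qPoch a q n ≠ 0)
    (n : ℕ) :
    littleQBesselTerm q a γ x (n + 1) =
      -(q ^ n * (q * γ * x)) / ((1 - a * q ^ n) * (1 - q ^ (n + 1))) *
        littleQBesselTerm q a γ x n := by
  have h1 := ha n
  have h2 := qPoch_self_ne_zero hq n
  have h3 := one_sub_mul_pow_ne_zero_of_qPoch ha n
  have h4 := one_sub_pow_succ_ne_zero hq n
  have h5 : qPoch q q (n + 1) = qPoch q q n * (1 - q ^ (n + 1)) := by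
    rw [qPoch_succ, ← pow_succ']
  rw [littleQBesselTerm, littleQBesselTerm, Nat.triangle_succ, pow_add q, qPoch_succ a, h5,
    pow_succ (-1 : ℂ), pow_succ (q * γ * x)]
  generalize q ^ (n + 1) = r at *
  field_simp

lemma summable_littleQBesselTerm {q a : ℂ} (γ x : ℂ) (hq : ‖q‖ < 1)
    (ha : ∀ n, qPoch a q n ≠ 0) : Summable (littleQBesselTerm q a γ x) := by
  have hpow := tendsto_pow_atTop_nhds_zero_of_norm_lt_one hq
  have hratio : Filter.Tendsto
      (fun n : ℕ => ‖-(q ^ n * (q * γ * x)) / ((1 - a * q ^ n) * (1 - q ^ (n + 1)))‖)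
      Filter.atTop (nhds 0) := by
    have hden := ((hpow.const_mul a).const_sub 1).mul
      (((Filter.tendsto_add_atTop_iff_nat 1).mpr hpow).const_sub 1)
    simpa using ((hpow.mul_const (q * γ * x)).neg.div hden (by simp)).norm
  refine summable_of_ratio_norm_eventually_le (r := 1 / 2) (by norm_num) ?_
  filter_upwards [hratio.eventually_le_const (by norm_num : (0 : ℝ) < 1 / 2)] with n hn
  rw [littleQBesselTerm_succ γ x hq ha, norm_mul]
  gcongr

lemma littleQBesselTerm_qDifference_succ {q a : ℂ} (γ : ℂ) {x : ℂ} (hq0 : q ≠ 0) (hq : ‖q‖ < 1)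
    (hx : x ≠ 0) (ha : ∀ n, qPoch a q n ≠ 0) (n : ℕ) :
    (a / x) * (littleQBesselTerm q a γ (q * x) (n + 1) - littleQBesselTerm q a γ x (n + 1)) +
      (q / x) *
        (littleQBesselTerm q a γ (q⁻¹ * x) (n + 1) - littleQBesselTerm q a γ x (n + 1)) =
      -q * γ * littleQBesselTerm q a γ x n := by
  have h3 := one_sub_mul_pow_ne_zero_of_qPoch ha n
  have h4 := one_sub_pow_succ_ne_zero hq n
  rw [littleQBesselTerm_mul, littleQBesselTerm_mul, littleQBesselTerm_succ γ x hq ha]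
  have h6 : q ^ n ≠ 0 := pow_ne_zero n hq0
  rw [inv_pow]
  rw [pow_succ] at h4 ⊢
  generalize q ^ n = r at *
  field_simp
  ring

theorem littleQBessel_qDifference_eq (q : ℝ) (hq0 : 0 < q) (hq1 : q < 1)
    (a γ x : ℂ) (hx : x ≠ 0)
    (ha : ∀ n : ℕ, qPoch a (q : ℂ) n ≠ 0) :
    (a / x) * (littleQBessel (q : ℂ) a γ ((q : ℂ) * x) - littleQBessel (q : ℂ) a γ x) +
      ((q : ℂ) / x) *
        (littleQBessel (q : ℂ) a γ ((q : ℂ)⁻¹ * x) - littleQBessel (q : ℂ) a γ x) =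
      -(q : ℂ) * γ * littleQBessel (q : ℂ) a γ x := by
  have hqC : (q : ℂ) ≠ 0 := Complex.ofReal_ne_zero.mpr hq0.ne'
  have hq : ‖(q : ℂ)‖ < 1 := by rwa [Complex.norm_real, Real.norm_of_nonneg hq0.le]
  have hs (y : ℂ) : HasSum (littleQBesselTerm q a γ y) (littleQBessel q a γ y) :=
    (summable_littleQBesselTerm γ y hq ha).hasSum
  have hL := (((hs (q * x)).sub (hs x)).mul_left (a / x)).add
    (((hs ((q : ℂ)⁻¹ * x)).sub (hs x)).mul_left ((q : ℂ) / x))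
  rw [← hasSum_nat_add_iff' 1] at hL
  simp only [littleQBesselTerm_qDifference_succ γ hqC hq hx ha] at hL
  simpa [littleQBesselTerm] using hL.unique ((hs x).mul_left (-(q : ℂ) * γ))
end

section
/- Let a, b, x, γ be nonzero complex numbers with (ab;q)_n ≠ 0 for all n ≥ 0. Then, as the real parameter ε tends to 0 from above (so that |b·x·ε| < 1 for all sufficiently small ε and the left-hand side is defined), φ_{γε}(x·ε;a;b;q) tends to ₁φ₁(0; ab; q, −a·b·x/γ). -/
open Filter Topology

/-- The little q-Jacobi function
`φ_γ(x;a;b;q) = ∑_{n≥0} (aγ;q)_n (a/γ;q)_n / ((ab;q)_n (q;q)_n) (-bx)^n`. -/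
noncomputable def littleQJacobi (q a b γ x : ℂ) : ℂ :=
  ∑' n : ℕ, qPoch (a * γ) q n * qPoch (a / γ) q n /
    (qPoch (a * b) q n * qPoch q q n) * (-(b * x)) ^ n

/-- The basic hypergeometric series
`₁φ₁(α;β;q,z) = ∑_{n≥0} (α;q)_n (-1)^n q^{n(n-1)/2} / ((β;q)_n (q;q)_n) z^n`. -/
noncomputable def phi11 (q α β z : ℂ) : ℂ :=
  ∑' n : ℕ, qPoch α q n * (-1) ^ n * q ^ (n * (n - 1) / 2) /
    (qPoch β q n * qPoch q q n) * z ^ n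

/-- The `j`-th factor of the summands of `littleQJacobi q a b (γ * ε) (x * ε)`, written so that it
makes sense at `ε = 0`. -/
noncomputable def qJacobiFactor (q a b γ x ε : ℂ) (j : ℕ) : ℂ :=
  (1 - a * γ * ε * q ^ j) * (ε - a / γ * q ^ j) * (-(b * x)) /
    ((1 - a * b * q ^ j) * (1 - q * q ^ j))

/-- A bound for `‖qJacobiFactor q a b γ x ε j‖` that is uniform in `‖ε‖ ≤ δ`. -/
noncomputable def qJacobiFactorBound (q a b γ x : ℂ) (δ : ℝ) (j : ℕ) : ℝ :=
  (1 + ‖a * γ‖ * δ * ‖q‖ ^ j) * (δ + ‖a / γ‖ * ‖q‖ ^ j) * ‖b * x‖ /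
    (‖1 - a * b * q ^ j‖ * ‖1 - q * q ^ j‖)

theorem littleQJacobi_eq_tsum_prod (q a b γ x : ℂ) {ε : ℂ} (hε : ε ≠ 0) :
    littleQJacobi q a b (γ * ε) (x * ε) =
      ∑' n : ℕ, ∏ j ∈ Finset.range n, qJacobiFactor q a b γ x ε j := by
  unfold littleQJacobi qPoch qJacobiFactor
  refine tsum_congr fun n => ?_
  have hpow (z : ℂ) : z ^ n = ∏ _j ∈ Finset.range n, z := by simp
  rw [hpow, ← Finset.prod_mul_distrib, ← Finset.prod_mul_distrib, ← Finset.prod_div_distrib,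
    ← Finset.prod_mul_distrib]
  refine Finset.prod_congr rfl fun j _ => ?_
  have h : (1 - a / (γ * ε) * q ^ j) * ε = ε - a / γ * q ^ j := by
    rw [← div_div]
    field_simp
  rw [← h]
  ring

theorem phi11_eq_tsum_prod (q a b γ x : ℂ) :
    phi11 q 0 (a * b) (-(a * b * x / γ)) =
      ∑' n : ℕ, ∏ j ∈ Finset.range n, qJacobiFactor q a b γ x 0 j := by
  unfold phi11 qPoch qJacobiFactor
  refine tsum_congr fun n => ?_
  have hprod : q ^ (n * (n - 1) / 2) = ∏ j ∈ Finset.range n, q ^ j := by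
    rw [Finset.prod_pow_eq_pow_sum, Finset.sum_range_id]
  have hpow (z : ℂ) : z ^ n = ∏ _j ∈ Finset.range n, z := by simp
  rw [hprod, hpow, hpow, ← Finset.prod_mul_distrib, ← Finset.prod_mul_distrib,
    ← Finset.prod_mul_distrib, ← Finset.prod_div_distrib, ← Finset.prod_mul_distrib]
  refine Finset.prod_congr rfl fun j _ => ?_
  ring

theorem norm_qJacobiFactor_le (q a b γ x : ℂ) {ε : ℂ} {δ : ℝ} (hε : ‖ε‖ ≤ δ) (j : ℕ) :
    ‖qJacobiFactor q a b γ x ε j‖ ≤ qJacobiFactorBound q a b γ x δ j := by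
  have hδ : 0 ≤ δ := (norm_nonneg ε).trans hε
  have h₁ : ‖1 - a * γ * ε * q ^ j‖ ≤ 1 + ‖a * γ‖ * δ * ‖q‖ ^ j := by
    refine (norm_sub_le _ _).trans ?_
    rw [norm_one, norm_mul, norm_mul (a * γ), norm_pow]
    gcongr
  have h₂ : ‖ε - a / γ * q ^ j‖ ≤ δ + ‖a / γ‖ * ‖q‖ ^ j := by
    refine (norm_sub_le _ _).trans ?_
    rw [norm_mul, norm_pow]
    gcongr
  unfold qJacobiFactor qJacobiFactorBound
  rw [norm_div, norm_mul, norm_mul, norm_neg, norm_mul (1 - a * b * q ^ j)]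
  gcongr

theorem tendsto_qJacobiFactorBound (q a b γ x : ℂ) (hq : ‖q‖ < 1) (δ : ℝ) :
    Tendsto (qJacobiFactorBound q a b γ x δ) atTop (𝓝 (δ * ‖b * x‖)) := by
  have hr : Tendsto (fun j : ℕ => ‖q‖ ^ j) atTop (𝓝 0) :=
    tendsto_pow_atTop_nhds_zero_of_lt_one (norm_nonneg q) hq
  have hc : Tendsto (fun j : ℕ => q ^ j) atTop (𝓝 0) :=
    tendsto_pow_atTop_nhds_zero_of_norm_lt_one hq
  have hden (c : ℂ) : Tendsto (fun j : ℕ => ‖1 - c * q ^ j‖) atTop (𝓝 1) := by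
    simpa using ((hc.const_mul c).const_sub 1).norm
  have h := (((((hr.const_mul (‖a * γ‖ * δ)).const_add 1).mul
    ((hr.const_mul ‖a / γ‖).const_add δ)).mul_const ‖b * x‖).div
    ((hden (a * b)).mul (hden q)) (by norm_num))
  simp only [mul_zero, add_zero, mul_one, one_mul, div_one] at h
  exact h

theorem one_sub_mul_pow_ne_zero_of_qPoch_ne_zero {a q : ℂ} {j : ℕ} (h : qPoch a q (j + 1) ≠ 0) :
    1 - a * q ^ j ≠ 0 :=
  Finset.prod_ne_zero_iff.mp h j (Finset.self_mem_range_succ j)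

theorem one_sub_mul_pow_ne_zero_of_norm_lt_one {q : ℂ} (hq : ‖q‖ < 1) (j : ℕ) :
    1 - q * q ^ j ≠ 0 := by
  rw [← pow_succ', sub_ne_zero]
  intro h
  have : ‖q ^ (j + 1)‖ < 1 := by
    rw [norm_pow]
    exact pow_lt_one₀ (norm_nonneg q) hq j.succ_ne_zero
  rw [← h, norm_one] at this
  exact this.false

theorem summable_prod_range_of_tendsto_lt_one {B : ℕ → ℝ} {l : ℝ} (hB : ∀ j, 0 < B j)
    (hl : l < 1) (h : Tendsto B atTop (𝓝 l)) :
    Summable fun n => ∏ j ∈ Finset.range n, B j := by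
  have hpos (n : ℕ) : 0 < ∏ j ∈ Finset.range n, B j := Finset.prod_pos fun j _ => hB j
  refine summable_of_ratio_test_tendsto_lt_one hl (.of_forall fun n => (hpos n).ne') ?_
  refine h.congr fun n => ?_
  rw [Real.norm_of_nonneg (hpos _).le, Real.norm_of_nonneg (hpos _).le, Finset.prod_range_succ,
    mul_div_cancel_left₀ _ (hpos n).ne']

theorem littleQJacobi_to_littleQBessel (q : ℝ) (hq0 : 0 < q) (hq1 : q < 1)
    (a b γ x : ℂ) (ha : a ≠ 0) (hb : b ≠ 0) (hγ : γ ≠ 0) (hx : x ≠ 0)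
    (hab : ∀ n : ℕ, qPoch (a * b) (q : ℂ) n ≠ 0) :
    Tendsto (fun ε : ℝ => littleQJacobi (q : ℂ) a b (γ * (ε : ℂ)) (x * (ε : ℂ)))
      (𝓝[>] (0 : ℝ)) (𝓝 (phi11 (q : ℂ) 0 (a * b) (-(a * b * x / γ)))) := by
  have hq : ‖(q : ℂ)‖ < 1 := by
    rwa [Complex.norm_real, Real.norm_of_nonneg hq0.le]
  have hbx : 0 < ‖b * x‖ := norm_pos_iff.mpr (mul_ne_zero hb hx)
  set δ : ℝ := 1 / (2 * ‖b * x‖) with hδ_def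
  have hδ : 0 < δ := by positivity
  have hδ_lt : δ * ‖b * x‖ < 1 := by
    rw [hδ_def]
    field_simp
    norm_num
  have hB (j : ℕ) : 0 < qJacobiFactorBound q a b γ x δ j := by
    have h₁ := norm_pos_iff.mpr (one_sub_mul_pow_ne_zero_of_qPoch_ne_zero (hab (j + 1)))
    have h₂ := norm_pos_iff.mpr (one_sub_mul_pow_ne_zero_of_norm_lt_one hq j)
    unfold qJacobiFactorBound
    positivity
  have hsum := summable_prod_range_of_tendsto_lt_one hB hδ_lt
    (tendsto_qJacobiFactorBound (q : ℂ) a b γ x hq δ)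
  rw [phi11_eq_tsum_prod]
  have hlim : Tendsto (fun ε : ℝ => ∑' n : ℕ, ∏ j ∈ Finset.range n, qJacobiFactor q a b γ x ε j)
      (𝓝[>] 0) (𝓝 (∑' n : ℕ, ∏ j ∈ Finset.range n, qJacobiFactor q a b γ x 0 j)) := by
    refine tendsto_tsum_of_dominated_convergence hsum (fun n => ?_) ?_
    · have hcont : Continuous fun ε : ℝ =>
          ∏ j ∈ Finset.range n, qJacobiFactor q a b γ x ε j := by
        unfold qJacobiFactor
        fun_prop
      simpa using (hcont.tendsto 0).mono_left nhdsWithin_le_nhds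
    · filter_upwards [Ioc_mem_nhdsGT hδ] with ε hε n
      rw [norm_prod]
      refine Finset.prod_le_prod (fun _ _ => norm_nonneg _) fun j _ =>
        norm_qJacobiFactor_le _ _ _ _ _ ?_ j
      rw [Complex.norm_real, Real.norm_of_nonneg hε.1.le]
      exact hε.2
  refine hlim.congr' ?_
  filter_upwards [self_mem_nhdsWithin] with ε hε
  exact (littleQJacobi_eq_tsum_prod _ a b γ x (Complex.ofReal_ne_zero.mpr (ne_of_gt hε))).symm
end

section
/- Let a, b, c, γ, x be nonzero complex numbers with (ab;q)_n ≠ 0 for all n ≥ 0. Then, as the real parameter ε tends to 0 from above (so that for all sufficiently small ε one has |b·cε·x| < 1 and (a·cε;q)_n ≠ 0 for all n, making the left-hand side defined), the big q-Jacobi function φ_{γε}(x;a;b,cε;q) tends to the big q-Bessel function J_{−c/γ}(x;ab;q) = ₁φ₁(−1/x; ab; q, −a·b·c·x/γ). -/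
open Filter Topology

/-- The big q-Jacobi function
`φ_γ(x;a;b,c;q) = ∑ (aγ;q)_n (a/γ;q)_n (-1/x;q)_n / ((ab;q)_n (ac;q)_n (q;q)_n) (-bcx)^n`. -/
noncomputable def bigQJacobi (q a b c γ x : ℂ) : ℂ :=
  ∑' n : ℕ, qPoch (a * γ) q n * qPoch (a / γ) q n * qPoch (-1 / x) q n /
    (qPoch (a * b) q n * qPoch (a * c) q n * qPoch q q n) * (-(b * c * x)) ^ n

/-- The big q-Bessel function
`J_γ(x;a;q) = ∑ (-1/x;q)_n (-1)^n q^{n(n-1)/2} / ((a;q)_n (q;q)_n) (aγx)^n`. -/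
noncomputable def bigQBessel (q a γ x : ℂ) : ℂ :=
  ∑' n : ℕ, qPoch (-1 / x) q n * (-1) ^ n * q ^ (n * (n - 1) / 2) /
    (qPoch a q n * qPoch q q n) * (a * γ * x) ^ n

/-- Dominated convergence for series whose terms are partial products, when the factors
tend to `0` jointly in the parameter and the index. -/
lemma tendsto_tsum_prod_range {α : Type*} {l : Filter α} {r : α → ℕ → ℂ} {s : ℕ → ℂ}
    (hr : ∀ j, Tendsto (fun t => r t j) l (𝓝 (s j)))
    (h0 : Tendsto (fun p : α × ℕ => r p.1 p.2) (l ×ˢ atTop) (𝓝 0)) :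
    Tendsto (fun t => ∑' n, ∏ j ∈ Finset.range n, r t j) l
      (𝓝 (∑' n, ∏ j ∈ Finset.range n, s j)) := by
  have hsmall : ∀ᶠ p : α × ℕ in l ×ˢ atTop, ‖r p.1 p.2‖ < 1 / 2 :=
    h0.norm.eventually_lt_const (by norm_num)
  obtain ⟨P, hP, Q, hQ, hPQ⟩ := eventually_prod_iff.1 hsmall
  obtain ⟨N, hN⟩ := eventually_atTop.1 hQ
  let B : ℕ → ℝ := fun j => if j < N then ‖s j‖ + 1 else 1 / 2
  have hBpos : ∀ j, 0 < B j := fun j => by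
    dsimp only [B]
    split_ifs <;> positivity
  have hBsum : Summable fun n => ∏ j ∈ Finset.range n, B j := by
    refine summable_of_ratio_test_tendsto_lt_one (l := 1 / 2) (by norm_num)
      (.of_forall fun n => (Finset.prod_pos fun j _ => hBpos j).ne') ?_
    refine tendsto_const_nhds.congr' ?_
    filter_upwards [eventually_ge_atTop N] with n hn
    have hprod : 0 < ∏ j ∈ Finset.range n, B j := Finset.prod_pos fun j _ => hBpos j
    rw [Finset.prod_range_succ, norm_mul, mul_div_cancel_left₀ _ (norm_ne_zero_iff.2 hprod.ne'),
      Real.norm_of_nonneg (hBpos n).le]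
    simp [B, hn.not_gt]
  refine tendsto_tsum_of_dominated_convergence hBsum
    (fun n => tendsto_finsetProd _ fun j _ => hr j) ?_
  have hfirst : ∀ᶠ t in l, ∀ j ∈ Finset.range N, ‖r t j‖ < ‖s j‖ + 1 :=
    (Finset.eventually_all _).2 fun j _ => (hr j).norm.eventually_lt_const (lt_add_one _)
  filter_upwards [hP, hfirst] with t ht hfirst n
  rw [norm_prod]
  refine Finset.prod_le_prod (fun _ _ => norm_nonneg _) fun j _ => ?_
  dsimp only [B]
  split_ifs with hj
  · exact (hfirst j (Finset.mem_range.2 hj)).le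
  · exact (hPQ ht (hN j (not_lt.1 hj))).le

/-- The ratio of consecutive terms of the series for `φ_{γe}(x;a;b,ce;q)`, as a function of `e`
and `u = q ^ n`; it extends continuously to `e = 0`. -/
noncomputable def bigQJacobiRatio (q a b c γ x e u : ℂ) : ℂ :=
  (1 - a * γ * e * u) * (e - a / γ * u) * (1 - -1 / x * u) * (-(b * c * x)) /
    ((1 - a * b * u) * (1 - a * c * e * u) * (1 - q * u))

lemma bigQJacobi_eq_tsum_prod {q a b c γ x e : ℂ} (he : e ≠ 0) :
    bigQJacobi q a b (c * e) (γ * e) x =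
      ∑' n, ∏ j ∈ Finset.range n, bigQJacobiRatio q a b c γ x e (q ^ j) := by
  refine tsum_congr fun n => ?_
  have hpow (z : ℂ) : z ^ n = ∏ _j ∈ Finset.range n, z := by simp
  simp only [qPoch]
  rw [hpow]
  simp only [← Finset.prod_mul_distrib, ← Finset.prod_div_distrib]
  refine Finset.prod_congr rfl fun j _ => ?_
  have hfactor : e - a / γ * q ^ j = e * (1 - a / (γ * e) * q ^ j) := by
    rw [mul_sub, mul_one, ← div_div]
    field_simp
  rw [bigQJacobiRatio, hfactor]
  ring

lemma bigQBessel_eq_tsum_prod {q a b c γ x : ℂ} :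
    bigQBessel q (a * b) (-(c / γ)) x =
      ∑' n, ∏ j ∈ Finset.range n, bigQJacobiRatio q a b c γ x 0 (q ^ j) := by
  refine tsum_congr fun n => ?_
  have hpow (z : ℂ) : z ^ n = ∏ _j ∈ Finset.range n, z := by simp
  rw [← Finset.sum_range_id, ← Finset.prod_pow_eq_pow_sum]
  simp only [qPoch]
  rw [hpow, hpow]
  simp only [← Finset.prod_mul_distrib, ← Finset.prod_div_distrib]
  refine Finset.prod_congr rfl fun j _ => ?_
  rw [bigQJacobiRatio]
  ring

lemma tendsto_bigQJacobiRatio {α : Type*} {l : Filter α} {f g : α → ℂ} {q a b c γ x u : ℂ}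
    (hab : 1 - a * b * u ≠ 0) (hq : 1 - q * u ≠ 0)
    (hf : Tendsto f l (𝓝 0)) (hg : Tendsto g l (𝓝 u)) :
    Tendsto (fun t => bigQJacobiRatio q a b c γ x (f t) (g t)) l
      (𝓝 (bigQJacobiRatio q a b c γ x 0 u)) := by
  have hcont : ContinuousAt (fun p : ℂ × ℂ =>
      (1 - a * γ * p.1 * p.2) * (p.1 - a / γ * p.2) * (1 - -1 / x * p.2) * (-(b * c * x)) /
        ((1 - a * b * p.2) * (1 - a * c * p.1 * p.2) * (1 - q * p.2))) (0, u) := by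
    have hden : (1 - a * b * u) * (1 - a * c * 0 * u) * (1 - q * u) ≠ 0 := by
      simpa using ⟨hab, hq⟩
    exact ContinuousAt.div (Continuous.continuousAt (by fun_prop))
      (Continuous.continuousAt (by fun_prop)) hden
  have h := hcont.tendsto.comp (hf.prodMk_nhds hg)
  simpa only [bigQJacobiRatio, Function.comp_def] using h

theorem bigQJacobi_to_bigQBessel (q : ℝ) (hq0 : 0 < q) (hq1 : q < 1)
    (a b c γ x : ℂ) (ha : a ≠ 0) (hb : b ≠ 0) (hc : c ≠ 0) (hγ : γ ≠ 0) (hx : x ≠ 0)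
    (hab : ∀ n : ℕ, qPoch (a * b) (q : ℂ) n ≠ 0) :
    Tendsto (fun ε : ℝ => bigQJacobi (q : ℂ) a b (c * (ε : ℂ)) (γ * (ε : ℂ)) x)
        (𝓝[>] (0 : ℝ)) (𝓝 (bigQBessel (q : ℂ) (a * b) (-(c / γ)) x)) ∧
      bigQBessel (q : ℂ) (a * b) (-(c / γ)) x =
        phi11 (q : ℂ) (-1 / x) (a * b) (-(a * b * c * x / γ)) := by
  have hε : Tendsto (fun ε : ℝ => (ε : ℂ)) (𝓝[>] 0) (𝓝 0) :=
    (Complex.continuous_ofReal.tendsto' 0 0 Complex.ofReal_zero).mono_left nhdsWithin_le_nhds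
  have hpow : Tendsto (fun j : ℕ => (q : ℂ) ^ j) atTop (𝓝 0) :=
    tendsto_pow_atTop_nhds_zero_of_norm_lt_one (by simpa [abs_of_pos hq0] using hq1)
  refine ⟨?_, ?_⟩
  · rw [bigQBessel_eq_tsum_prod]
    have hlim : Tendsto (fun ε : ℝ => ∑' n, ∏ j ∈ Finset.range n,
        bigQJacobiRatio q a b c γ x ε ((q : ℂ) ^ j)) (𝓝[>] 0)
        (𝓝 (∑' n, ∏ j ∈ Finset.range n, bigQJacobiRatio q a b c γ x 0 ((q : ℂ) ^ j))) := by
      refine tendsto_tsum_prod_range (fun j => ?_) ?_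
      · have habj : 1 - a * b * (q : ℂ) ^ j ≠ 0 :=
          Finset.prod_ne_zero_iff.1 (hab (j + 1)) j (Finset.self_mem_range_succ j)
        have hqj : 1 - (q : ℂ) * (q : ℂ) ^ j ≠ 0 := by
          rw [← pow_succ', sub_ne_zero]
          exact_mod_cast (pow_lt_one₀ hq0.le hq1 j.succ_ne_zero).ne'
        exact tendsto_bigQJacobiRatio habj hqj hε tendsto_const_nhds
      · have h := tendsto_bigQJacobiRatio (q := q) (a := a) (b := b) (c := c) (γ := γ) (x := x)
          (by simp) (by simp) (hε.comp tendsto_fst) (hpow.comp tendsto_snd)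
        have hzero : bigQJacobiRatio q a b c γ x 0 0 = 0 := by simp [bigQJacobiRatio]
        rwa [hzero] at h
    refine hlim.congr' ?_
    filter_upwards [self_mem_nhdsWithin] with ε hεpos
    exact (bigQJacobi_eq_tsum_prod (Complex.ofReal_ne_zero.2 (ne_of_gt hεpos))).symm
  · rw [bigQBessel, phi11]
    congr! 4
    ring
end
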